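/- Let S be an inverse semigroup and N a normal inverse subsemigroup of S. The equivalence relation ≃_N saturates N: if s ∈ S, n ∈ N and s ≃_N n, then s ∈ N. Consequently N is the union of the ≃_N-classes of the idempotents of S. -/

import Mathlib

/-- An inverse semigroup: a semigroup in which every element `s` has a
(unique) inverse `s⁻¹` with `s * s⁻¹ * s = s` and `s⁻¹ * s * s⁻¹ = s⁻¹`. -/
class InverseSemigroup (S : Type*) extends Semigroup S, Inv S where
  mul_inv_mul : ∀ s : S, s * s⁻¹ * s = s
  inv_mul_inv : ∀ s : S, s⁻¹ * s * s⁻¹ = s⁻¹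
  inv_unique : ∀ s t : S, s * t * s = s → t * s * t = t → t = s⁻¹

/-- The natural partial order on an inverse semigroup:
`s ≤ t` iff `s = e * t` for some idempotent `e`. -/
def NatLe {S : Type*} [InverseSemigroup S] (s t : S) : Prop :=
  ∃ e : S, IsIdempotentElem e ∧ s = e * t

/-- A normal inverse subsemigroup: a full inverse subsemigroup that is
closed under conjugation. -/
structure IsNormalInverseSubsemigroup {S : Type*} [InverseSemigroup S] (N : Set S) : Prop where
  mul_mem : ∀ {a b : S}, a ∈ N → b ∈ N → a * b ∈ N
  inv_mem : ∀ {a : S}, a ∈ N → a⁻¹ ∈ N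
  full : ∀ {e : S}, IsIdempotentElem e → e ∈ N
  conj_mem : ∀ (s : S) {n : S}, n ∈ N → s⁻¹ * n * s ∈ N

/-- The preorder `≤_N` associated to a normal inverse subsemigroup `N`:
`s ≤_N t` iff there are `a, b ∈ N` with `a⁻¹ * a = s * s⁻¹`,
`s⁻¹ * s = b * b⁻¹` (so `a · s · b` is a trace product) and `a * s * b ≤ t`. -/
def LeN {S : Type*} [InverseSemigroup S] (N : Set S) (s t : S) : Prop :=
  ∃ a ∈ N, ∃ b ∈ N, a⁻¹ * a = s * s⁻¹ ∧ s⁻¹ * s = b * b⁻¹ ∧ NatLe (a * s * b) t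

/-- The equivalence `≃_N` obtained by symmetrizing `≤_N`. -/
def SimeqN {S : Type*} [InverseSemigroup S] (N : Set S) (s t : S) : Prop :=
  LeN N s t ∧ LeN N t s

namespace InverseSemigroup

variable {S : Type*} [InverseSemigroup S]

theorem inv_inv_eq (s : S) : s⁻¹⁻¹ = s :=
  (inv_unique _ _ (inv_mul_inv s) (mul_inv_mul s)).symm

theorem inv_eq_self {e : S} (he : IsIdempotentElem e) : e⁻¹ = e :=
  (inv_unique e e (by rw [he.eq, he.eq]) (by rw [he.eq, he.eq])).symm

theorem isIdempotentElem_mul_inv (s : S) : IsIdempotentElem (s * s⁻¹) := by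
  rw [IsIdempotentElem, ← mul_assoc, mul_inv_mul]

end InverseSemigroup

theorem NatLe.refl {S : Type*} [InverseSemigroup S] (s : S) : NatLe s s :=
  ⟨s * s⁻¹, InverseSemigroup.isIdempotentElem_mul_inv s, (InverseSemigroup.mul_inv_mul s).symm⟩

namespace IsNormalInverseSubsemigroup

open InverseSemigroup

variable {S : Type*} [InverseSemigroup S] {N : Set S}

theorem mem_of_leN (hN : IsNormalInverseSubsemigroup N) {s n : S} (hn : n ∈ N)
    (h : LeN N s n) : s ∈ N := by
  obtain ⟨a, ha, b, hb, hab, hba, e, he, hle⟩ := h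
  have hs : s = a⁻¹ * (a * s * b) * b⁻¹ := calc
    s = s * s⁻¹ * s * (s⁻¹ * s) := by rw [mul_inv_mul, ← mul_assoc, mul_inv_mul]
    _ = a⁻¹ * (a * s * b) * b⁻¹ := by rw [← hab, hba]; simp only [mul_assoc]
  rw [hs, hle]
  exact hN.mul_mem (hN.mul_mem (hN.inv_mem ha) (hN.mul_mem (hN.full he) hn)) (hN.inv_mem hb)

theorem simeqN_mul_inv (hN : IsNormalInverseSubsemigroup N) {s : S} (hs : s ∈ N) :
    SimeqN N s (s * s⁻¹) := by
  have he := isIdempotentElem_mul_inv s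
  have hinv := inv_eq_self he
  refine ⟨⟨s * s⁻¹, hN.full he, s⁻¹, hN.inv_mem hs, ?_, ?_, ?_⟩,
    ⟨s * s⁻¹, hN.full he, s, hs, ?_, ?_, ?_⟩⟩
  · rw [hinv, he.eq]
  · rw [inv_inv_eq]
  · rw [mul_inv_mul]
    exact NatLe.refl _
  · rw [hinv]
  · rw [hinv, he.eq]
  · rw [he.eq, mul_inv_mul]
    exact NatLe.refl _

end IsNormalInverseSubsemigroup

/-- `≃_N` saturates `N`, and `N` is the union of the `≃_N`-classes of the
idempotents of `S`. -/
theorem simeqN_saturates {S : Type*} [InverseSemigroup S] {N : Set S}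
    (hN : IsNormalInverseSubsemigroup N) :
    (∀ s n : S, n ∈ N → SimeqN N s n → s ∈ N) ∧
    N = {s : S | ∃ e : S, IsIdempotentElem e ∧ SimeqN N s e} := by
  refine ⟨fun s n hn h => hN.mem_of_leN hn h.1, Set.ext fun s => ⟨fun hs => ?_, ?_⟩⟩
  · exact ⟨s * s⁻¹, InverseSemigroup.isIdempotentElem_mul_inv s, hN.simeqN_mul_inv hs⟩
  · rintro ⟨e, he, h⟩
    exact hN.mem_of_leN (hN.full he) h.1
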